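/- arXiv:2008.01538 — 2 statements merged into one kernel-verified Lean document; each statement's English description precedes it below -/
import Mathlib

section
/- Let k be a field. If there exists a Lie algebra isomorphism FreeLieAlgebra k α ≃ₗ⁅k⁆ FreeLieAlgebra k β, then the cardinality of α equals the cardinality of β. -/
namespace FreeLieAlgebra

/-- The abelian Lie algebra whose underlying module is free on `X`. -/
def FreeAbelian (R X : Type*) [CommRing R] : Type _ := X →₀ R

namespace FreeAbelian

variable (R X : Type*) [CommRing R]

noncomputable instance : AddCommGroup (FreeAbelian R X) :=
  inferInstanceAs (AddCommGroup (X →₀ R))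

noncomputable instance : Module R (FreeAbelian R X) :=
  inferInstanceAs (Module R (X →₀ R))

noncomputable instance : LieRing (FreeAbelian R X) where
  bracket _ _ := 0
  add_lie _ _ _ := (add_zero 0).symm
  lie_add _ _ _ := (add_zero 0).symm
  lie_self _ := rfl
  leibniz_lie _ _ _ := (add_zero 0).symm

noncomputable instance : LieAlgebra R (FreeAbelian R X) where
  lie_smul r _ _ := (smul_zero r).symm

instance : IsLieAbelian (FreeAbelian R X) where
  trivial _ _ := rfl

/-- The standard basis of the free abelian Lie algebra. -/
noncomputable def basis : Module.Basis X R (FreeAbelian R X) :=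
  Module.Basis.ofRepr (LinearEquiv.refl R (X →₀ R))

end FreeAbelian

/-- The abelianization map of the free Lie algebra, sending generators to basis vectors. -/
noncomputable def toFreeAbelian (R X : Type*) [CommRing R] :
    FreeLieAlgebra R X →ₗ⁅R⁆ FreeAbelian R X :=
  lift R (FreeAbelian.basis R X)

theorem toFreeAbelian_of {R X : Type*} [CommRing R] (x : X) :
    toFreeAbelian R X (of R x) = FreeAbelian.basis R X x :=
  lift_of_apply _ x

theorem toFreeAbelian_surjective (R X : Type*) [CommRing R] :
    Function.Surjective (toFreeAbelian R X) := by
  change Function.Surjective (toFreeAbelian R X : FreeLieAlgebra R X →ₗ[R] FreeAbelian R X)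
  rw [← LinearMap.range_eq_top, eq_top_iff, ← (FreeAbelian.basis R X).span_eq, Submodule.span_le]
  rintro _ ⟨x, rfl⟩
  exact ⟨of R x, toFreeAbelian_of x⟩

/-- A Lie algebra homomorphism from a free Lie algebra to an abelian Lie algebra factors through
the abelianization. -/
theorem exists_linearMap_comp_toFreeAbelian {R X L : Type*} [CommRing R] [LieRing L]
    [LieAlgebra R L] [IsLieAbelian L] (f : FreeLieAlgebra R X →ₗ⁅R⁆ L) :
    ∃ g : FreeAbelian R X →ₗ[R] L, ∀ a, g (toFreeAbelian R X a) = f a := by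
  let g : FreeAbelian R X →ₗ[R] L := (FreeAbelian.basis R X).constr R (f ∘ of R)
  let g' : FreeAbelian R X →ₗ⁅R⁆ L :=
    { g with
      map_lie' := fun {x y} => by
        change g ⁅x, y⁆ = ⁅g x, g y⁆
        rw [trivial_lie_zero, trivial_lie_zero, map_zero] }
  have hg : g'.comp (toFreeAbelian R X) = f := by
    ext x
    change g (toFreeAbelian R X (of R x)) = f (of R x)
    rw [toFreeAbelian_of, Module.Basis.constr_basis, Function.comp_apply]
  exact ⟨g, fun a => LieHom.congr_fun hg a⟩

theorem mk_le_mk_of_surjective {R : Type*} {X Y : Type u} [CommRing R] [Nontrivial R]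
    (f : FreeLieAlgebra R X →ₗ⁅R⁆ FreeLieAlgebra R Y) (hf : Function.Surjective f) :
    Cardinal.mk Y ≤ Cardinal.mk X := by
  obtain ⟨g, hg⟩ := exists_linearMap_comp_toFreeAbelian ((toFreeAbelian R Y).comp f)
  have hsurj : Function.Surjective g := by
    intro y
    obtain ⟨b, rfl⟩ := toFreeAbelian_surjective R Y y
    obtain ⟨a, rfl⟩ := hf b
    exact ⟨toFreeAbelian R X a, hg a⟩
  rw [← Cardinal.lift_le, (FreeAbelian.basis R X).mk_eq_rank, (FreeAbelian.basis R Y).mk_eq_rank,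
    Cardinal.lift_le]
  exact LinearMap.rank_le_of_surjective g hsurj

end FreeLieAlgebra

/-- Isomorphic free Lie algebras over a field have equinumerous sets of free generators. -/
theorem freeLieAlgebra_iso_gives_card_eq {k : Type*} [Field k] {α β : Type u}
    (h : Nonempty (FreeLieAlgebra k α ≃ₗ⁅k⁆ FreeLieAlgebra k β)) :
    Cardinal.mk α = Cardinal.mk β := by
  obtain ⟨e⟩ := h
  exact le_antisymm
    (FreeLieAlgebra.mk_le_mk_of_surjective e.symm.toLieHom e.symm.surjective)
    (FreeLieAlgebra.mk_le_mk_of_surjective e.toLieHom e.surjective)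
end

section
/- Let k be a field and let φ be a homomorphism of non-unital non-associative k-algebras from FreeNonUnitalNonAssocAlgebra k α to FreeNonUnitalNonAssocAlgebra k β (a k-linear multiplicative map). If φ is bijective, then the cardinality of α equals the cardinality of β. -/
/-- A type synonym for `M`, equipped with the zero multiplication. -/
def NullAlgebra (M : Type*) : Type _ := M

namespace NullAlgebra

variable {R M N : Type*} [Semiring R] [AddCommMonoid M] [Module R M] [AddCommMonoid N] [Module R N]

instance : NonUnitalNonAssocSemiring (NullAlgebra M) where
  __ := (inferInstance : AddCommMonoid M)
  mul _ _ := (0 : M)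
  left_distrib _ _ _ := (add_zero (0 : M)).symm
  right_distrib _ _ _ := (add_zero (0 : M)).symm
  zero_mul _ := rfl
  mul_zero _ := rfl

instance : Module R (NullAlgebra M) := inferInstanceAs (Module R M)

instance : IsScalarTower R (NullAlgebra M) (NullAlgebra M) :=
  ⟨fun r _ _ => (smul_zero (A := M) r).symm⟩

instance : SMulCommClass R (NullAlgebra M) (NullAlgebra M) :=
  ⟨fun r _ _ => smul_zero (A := M) r⟩

/-- A linear map is an algebra homomorphism for the zero multiplications. -/
def map (f : M →ₗ[R] N) : NullAlgebra M →ₙₐ[R] NullAlgebra N where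
  toFun := f
  map_smul' := f.map_smul
  map_zero' := f.map_zero
  map_add' := f.map_add
  map_mul' _ _ := f.map_zero

end NullAlgebra

namespace FreeNonUnitalNonAssocAlgebra

variable {R α β : Type*} [CommSemiring R]

variable (R α) in
/-- The projection of the free algebra onto its linear part, the free algebra with zero
multiplication. -/
noncomputable def linearPart :
    FreeNonUnitalNonAssocAlgebra R α →ₙₐ[R] NullAlgebra (α →₀ R) :=
  lift R fun x => (Finsupp.single x 1 : α →₀ R)

theorem linearPart_of (x : α) :
    linearPart R α (of R x) = (Finsupp.single x 1 : α →₀ R) :=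
  lift_of_apply R _ x

/-- The linear map induced on linear parts by a homomorphism of free algebras. -/
noncomputable def mapLinearPart
    (φ : FreeNonUnitalNonAssocAlgebra R α →ₙₐ[R] FreeNonUnitalNonAssocAlgebra R β) :
    (α →₀ R) →ₗ[R] (β →₀ R) :=
  Finsupp.linearCombination R fun x => (linearPart R β (φ (of R x)) : β →₀ R)

theorem mapLinearPart_single
    (φ : FreeNonUnitalNonAssocAlgebra R α →ₙₐ[R] FreeNonUnitalNonAssocAlgebra R β) (x : α) :
    mapLinearPart φ (Finsupp.single x 1) = linearPart R β (φ (of R x)) :=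
  (Finsupp.linearCombination_single R 1 x).trans (one_smul R _)

theorem mapLinearPart_linearPart
    (φ : FreeNonUnitalNonAssocAlgebra R α →ₙₐ[R] FreeNonUnitalNonAssocAlgebra R β)
    (a : FreeNonUnitalNonAssocAlgebra R α) :
    mapLinearPart φ (linearPart R α a) = linearPart R β (φ a) := by
  have h : (NullAlgebra.map (mapLinearPart φ)).comp (linearPart R α) =
      (linearPart R β).comp φ := by
    apply hom_ext
    intro x
    change mapLinearPart φ (linearPart R α (of R x)) = linearPart R β (φ (of R x))
    rw [linearPart_of, mapLinearPart_single]
  exact DFunLike.congr_fun h a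

theorem mapLinearPart_comp_eq_id
    {φ : FreeNonUnitalNonAssocAlgebra R α →ₙₐ[R] FreeNonUnitalNonAssocAlgebra R β}
    {ψ : FreeNonUnitalNonAssocAlgebra R β →ₙₐ[R] FreeNonUnitalNonAssocAlgebra R α}
    (h : Function.LeftInverse ψ φ) :
    mapLinearPart ψ ∘ₗ mapLinearPart φ = LinearMap.id := by
  refine Finsupp.lhom_ext' fun x => LinearMap.ext_ring ?_
  change mapLinearPart ψ (mapLinearPart φ (Finsupp.single x 1)) = Finsupp.single x 1
  rw [mapLinearPart_single, mapLinearPart_linearPart, h, linearPart_of]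

end FreeNonUnitalNonAssocAlgebra

open FreeNonUnitalNonAssocAlgebra in
/-- A bijective homomorphism between free non-unital non-associative algebras over a field
forces the generating types to be equinumerous. -/
theorem freeNonUnitalNonAssocAlgebra_iso_gives_card_eq {k : Type*} [Field k]
    {α β : Type u}
    (φ : FreeNonUnitalNonAssocAlgebra k α →ₙₐ[k] FreeNonUnitalNonAssocAlgebra k β)
    (hφ : Function.Bijective φ) :
    Cardinal.mk α = Cardinal.mk β := by
  obtain ⟨g, hl, hr⟩ := Function.bijective_iff_has_inverse.mp hφ
  let ψ := φ.inverse g hl hr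
  let e : (α →₀ k) ≃ₗ[k] (β →₀ k) :=
    LinearEquiv.ofLinearMap (mapLinearPart φ) (mapLinearPart ψ)
      (mapLinearPart_comp_eq_id hr) (mapLinearPart_comp_eq_id hl)
  exact mk_eq_mk_of_basis' Finsupp.basisSingleOne (Module.Basis.ofRepr e)
end
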